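/- Let d, K be positive integers, let s⁰, …, s^{K−1} ∈ ℝ^d be sign vectors, let α⁰, …, α^{K−1} be nonnegative reals with ∑_{l=0}^{K−1} α^l = 1, and let ε > 0. For l ≠ j let n^{lj} denote the number of coordinates i with s^l_i ≠ s^j_i. Then ‖ε ∑_{l=0}^{K−1} α^l s^l‖₂ = ε √d · √(1 − (2/d) ∑_{l ≠ j} α^l α^j n^{lj}), where the sum ranges over all ordered pairs (l, j) with l ≠ j. -/

import Mathlib

open Finset

/-- Theorem 1 (second form): for sign vectors `s⁰, …, s^{K-1} ∈ {±1}^d`, convex weights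
`α^l`, and `ε > 0`, the Euclidean norm of `ε ∑_l α^l s^l` equals
`ε √d √(1 - (2/d) ∑_{l≠j} α^l α^j n^{lj})`, where `n^{lj}` counts the coordinates on
which `s^l` and `s^j` differ. -/
theorem fw_linf_distortion_sign_changes (d K : ℕ) (hd : 0 < d) (hK : 0 < K)
    (s : Fin K → EuclideanSpace ℝ (Fin d))
    (hs : ∀ l : Fin K, ∀ i : Fin d, s l i = 1 ∨ s l i = -1)
    (α : Fin K → ℝ) (hα : ∀ l : Fin K, 0 ≤ α l) (hsum : ∑ l, α l = 1)
    (ε : ℝ) (hε : 0 < ε) :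
    ‖ε • ∑ l, α l • s l‖ =
      ε * Real.sqrt d *
        Real.sqrt (1 - (2 / d) * ∑ p ∈ Finset.univ.offDiag,
          α p.1 * α p.2 *
            ((Finset.univ.filter (fun i : Fin d => s p.1 i ≠ s p.2 i)).card : ℝ)) := by
  have hd' : (d : ℝ) ≠ 0 := by positivity
  have hinner : ∀ l j, inner ℝ (s l) (s j) =
      (d : ℝ) - 2 * ((Finset.univ.filter (fun i : Fin d => s l i ≠ s j i)).card : ℝ) := by
    intro l j
    have h1 : ∀ i, inner ℝ (s l i) (s j i) = (1 : ℝ) - 2 * (if s l i ≠ s j i then 1 else 0) := by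
      intro i
      rcases hs l i with h | h <;> rcases hs j i with h' | h' <;> rw [h, h'] <;> norm_num
    rw [PiLp.inner_apply, Finset.sum_congr rfl (fun i _ => h1 i), Finset.sum_sub_distrib,
      ← Finset.mul_sum, Finset.sum_boole]
    simp
  have hoff : ∑ p ∈ Finset.univ.offDiag, α p.1 * α p.2 *
        ((Finset.univ.filter (fun i : Fin d => s p.1 i ≠ s p.2 i)).card : ℝ) =
      ∑ l, ∑ j, α l * α j *
        ((Finset.univ.filter (fun i : Fin d => s l i ≠ s j i)).card : ℝ) := by
    rw [← Finset.sum_product']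
    apply Finset.sum_subset
    · intro p _
      simp
    · intro p _ hp
      have : p.1 = p.2 := by simpa using hp
      simp [this]
  have hsq : ‖∑ l, α l • s l‖ ^ 2 = d * (1 - (2 / d) * ∑ p ∈ Finset.univ.offDiag,
          α p.1 * α p.2 *
            ((Finset.univ.filter (fun i : Fin d => s p.1 i ≠ s p.2 i)).card : ℝ)) := by
    rw [hoff, ← real_inner_self_eq_norm_sq, sum_inner]
    have h2 : ∀ l, inner ℝ (α l • s l) (∑ j, α j • s j) = ∑ j, (d * (α l * α j) - 2 * (α l * α j *
        ((Finset.univ.filter (fun i : Fin d => s l i ≠ s j i)).card : ℝ))) := by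
      intro l
      rw [inner_sum]
      refine Finset.sum_congr rfl fun j _ => ?_
      rw [real_inner_smul_left, real_inner_smul_right, hinner]
      ring
    rw [Finset.sum_congr rfl (fun l _ => h2 l)]
    simp_rw [Finset.sum_sub_distrib, ← Finset.mul_sum]
    rw [hsum]
    simp only [mul_one]
    rw [hsum]
    field_simp
  rw [norm_smul, Real.norm_of_nonneg hε.le, mul_assoc, ← Real.sqrt_mul (Nat.cast_nonneg d), ← hsq,
    Real.sqrt_sq (norm_nonneg _)]
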